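/- Let n ≥ 1 and let B denote the closed unit ball in ℝⁿ. There is no map R : ℝⁿ → ℝⁿ that is C² on an open neighborhood of B, maps B into the unit sphere ∂B, and satisfies R(x) = x for every x ∈ ∂B (no smooth retraction of the ball onto its boundary sphere). -/

import Mathlib

open Metric Set MeasureTheory Polynomial
open scoped NNReal

section Determinant

variable {E : Type*} [NormedAddCommGroup E] [NormedSpace ℝ E] [FiniteDimensional ℝ E]

theorem ContinuousLinearMap.det_one_add_ne_zero {A : E →L[ℝ] E} (hA : ‖A‖ < 1) :
    (1 + A).det ≠ 0 := by
  have : CompleteSpace E := FiniteDimensional.complete ℝ E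
  have hu : IsUnit (1 + A) := by
    simpa using isUnit_one_sub_of_norm_lt_one (x := -A) (by simpa using hA)
  have := hu.map (ContinuousLinearMap.toLinearMapRingHom (R₁ := ℝ) (M₁ := E))
  exact (LinearMap.isUnit_det _ this).ne_zero

theorem ContinuousLinearMap.det_one_add_pos {A : E →L[ℝ] E} (hA : ‖A‖ < 1) :
    0 < (1 + A).det := by
  by_contra! hneg
  have hcont : ContinuousOn (fun s : ℝ => (1 + s • A).det) (Icc 0 1) :=
    (ContinuousLinearMap.continuous_det.comp (by fun_prop)).continuousOn
  have hone : (1 : E →L[ℝ] E).det = 1 := LinearMap.det_id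
  obtain ⟨s, hs, hs0⟩ := intermediate_value_Icc' zero_le_one hcont
    (show (0 : ℝ) ∈ Icc _ _ by simp [hneg, hone])
  refine ContinuousLinearMap.det_one_add_ne_zero (A := s • A) ?_ hs0
  rw [norm_smul, Real.norm_of_nonneg hs.1]
  exact (mul_le_of_le_one_left (norm_nonneg _) hs.2).trans_lt hA

theorem LinearMap.exists_polynomial_eval_eq_det_one_add_smul (A : E →ₗ[ℝ] E) :
    ∃ p : ℝ[X], p.natDegree ≤ Module.finrank ℝ E ∧
      ∀ t : ℝ, p.eval t = LinearMap.det (1 + t • A) := by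
  let b := Module.finBasis ℝ E
  let M := LinearMap.toMatrix b b A
  refine ⟨_, (Polynomial.natDegree_det_X_add_C_le M 1).trans (by simp), fun t => ?_⟩
  rw [← Polynomial.coe_evalRingHom, RingHom.map_det, ← LinearMap.det_toMatrix b]
  congr 1
  ext i j
  simp [M, Matrix.one_apply, LinearMap.toMatrix_one, apply_ite]
  split_ifs <;> ring

end Determinant

theorem Polynomial.exists_weights_eval_one_eq_sum (N : ℕ) {v : ℕ → ℝ}
    (hv : Function.Injective v) :
    ∃ c : ℕ → ℝ, ∀ p : ℝ[X], p.natDegree ≤ N →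
      p.eval 1 = ∑ i ∈ Finset.range (N + 1), c i * p.eval (v i) := by
  refine ⟨fun i => (Lagrange.basis (Finset.range (N + 1)) v i).eval 1, fun p hp => ?_⟩
  have h := Lagrange.eq_interpolate (f := p) (s := Finset.range (N + 1)) hv.injOn (by
    rw [Finset.card_range]
    exact p.degree_le_natDegree.trans_lt (by exact_mod_cast Nat.lt_succ_of_le hp))
  conv_lhs => rw [h]
  simp [Lagrange.interpolate_apply, Polynomial.eval_finsetSum, mul_comm]

section Ball

variable {E : Type*} [NormedAddCommGroup E] [NormedSpace ℝ E] [FiniteDimensional ℝ E]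

theorem ApproximatesLinearOn.image_ball_eq [Nontrivial E] {f : E → E} {c : ℝ≥0}
    (hf : ApproximatesLinearOn f (ContinuousLinearEquiv.refl ℝ E : E →L[ℝ] E)
      (closedBall 0 1) c) (hc : c < 1) (hmaps : MapsTo f (ball 0 1) (ball 0 1))
    (hfix : ∀ x ∈ sphere (0 : E) 1, f x = x) :
    f '' ball 0 1 = ball 0 1 := by
  have : CompleteSpace E := FiniteDimensional.complete ℝ E
  refine hmaps.image_subset.antisymm ?_
  have hopen : IsOpen (f '' ball 0 1) := by
    refine (hf.mono_set ball_subset_closedBall).open_image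
      (ContinuousLinearEquiv.refl ℝ E).toNonlinearRightInverse isOpen_ball (.inr ?_)
    have : (ContinuousLinearEquiv.refl ℝ E).toNonlinearRightInverse.nnnorm = 1 := by
      change ‖(ContinuousLinearMap.id ℝ E)‖₊ = 1
      ext; simp
    simpa [this] using hc
  have hclosed : IsClosed (f '' closedBall 0 1) :=
    ((isCompact_closedBall 0 1).image_of_continuousOn hf.continuousOn).isClosed
  refine (convex_ball (0 : E) 1).isPreconnected.subset_of_closure_inter_subset hopen
    ⟨f 0, hmaps (by simp), 0, by simp, rfl⟩ ?_
  rintro y ⟨hy, hy1⟩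
  obtain ⟨x, hx, rfl⟩ := closure_minimal (image_mono ball_subset_closedBall) hclosed hy
  rcases (mem_closedBall.1 hx).lt_or_eq with h | h
  · exact ⟨x, h, rfl⟩
  · rw [hfix x h] at hy1
    exact absurd h (mem_ball.1 hy1).ne

end Ball

section Retraction

variable {E : Type*} [NormedAddCommGroup E] [InnerProductSpace ℝ E] [FiniteDimensional ℝ E]

theorem det_fderiv_eq_zero_of_norm_eq_one {R : E → E} {x : E} (hR : DifferentiableAt ℝ R x)
    (hnorm : ∀ᶠ y in nhds x, ‖R y‖ = 1) : (fderiv ℝ R x).det = 0 := by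
  by_contra hdet
  have horth (v : E) : inner ℝ (R x) (fderiv ℝ R x v) = 0 := by
    have h1 := hR.hasFDerivAt.norm_sq
    have h2 : HasFDerivAt (fun y => ‖R y‖ ^ 2) (0 : E →L[ℝ] ℝ) x :=
      (hasFDerivAt_const (1 : ℝ) x).congr_of_eventuallyEq
        (hnorm.mono fun y hy => by simp [hy])
    simpa using DFunLike.congr_fun (h1.unique h2) v
  have hu := ((fderiv ℝ R x : E →ₗ[ℝ] E).isUnit_iff_isUnit_det).2 (isUnit_iff_ne_zero.2 hdet)
  obtain ⟨v, hv⟩ := ((Module.End.isUnit_iff _).1 hu).2 (R x)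
  have h0 := horth v
  rw [show fderiv ℝ R x v = R x from hv, real_inner_self_eq_norm_sq, hnorm.self_of_nhds] at h0
  norm_num at h0

variable [Nontrivial E]

theorem setIntegral_det_one_add_smul_fderiv [MeasurableSpace E] [BorelSpace E]
    (μ : Measure E) [μ.IsAddHaarMeasure] {R : E → E} {K : ℝ≥0}
    (hdiff : ∀ x ∈ ball (0 : E) 1, DifferentiableAt ℝ R x)
    (hLip : LipschitzOnWith K (fun x => R x - x) (closedBall 0 1))
    (hmaps : MapsTo R (closedBall 0 1) (closedBall 0 1))
    (hfix : ∀ x ∈ sphere (0 : E) 1, R x = x)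
    {t : ℝ≥0} (ht : t < 1) (htK : t * K < 1) :
    ∫ x in ball (0 : E) 1, (1 + (t : ℝ) • (fderiv ℝ R x - 1)).det ∂μ = μ.real (ball 0 1) := by
  set f : E → E := fun x => x + (t : ℝ) • (R x - x) with hf
  have happ : ApproximatesLinearOn f (ContinuousLinearEquiv.refl ℝ E : E →L[ℝ] E)
      (closedBall 0 1) (t * K) := by
    intro x hx y hy
    have : f x - f y - (x - y) = (t : ℝ) • ((R x - x) - (R y - y)) := by
      simp only [hf]; module
    simp only [ContinuousLinearEquiv.coe_refl, ContinuousLinearMap.coe_id', id, this, norm_smul]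
    have h := hLip.norm_sub_le hx hy
    simp only [NNReal.coe_mul, mul_assoc, Real.norm_of_nonneg t.coe_nonneg]
    gcongr
  have hmf : MapsTo f (ball 0 1) (ball 0 1) := by
    intro x hx
    have hRx := hmaps (ball_subset_closedBall hx)
    rw [mem_closedBall_zero_iff] at hRx
    rw [mem_ball_zero_iff] at hx ⊢
    have ht' : (t : ℝ) < 1 := by exact_mod_cast ht
    have : f x = (1 - (t : ℝ)) • x + (t : ℝ) • R x := by simp only [hf]; module
    rw [this]
    calc _ ≤ (1 - (t : ℝ)) * ‖x‖ + t * ‖R x‖ := by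
          refine (norm_add_le _ _).trans_eq ?_
          rw [norm_smul, norm_smul, Real.norm_of_nonneg (by linarith),
            Real.norm_of_nonneg t.coe_nonneg]
      _ < 1 := by nlinarith [t.coe_nonneg]
  have himage := happ.image_ball_eq htK hmf (fun x hx => by simp [hf, hfix x hx])
  have hinj : InjOn f (ball 0 1) := by
    refine (happ.mono_set ball_subset_closedBall).injOn (.inr ?_)
    have : ‖((ContinuousLinearEquiv.refl ℝ E).symm : E →L[ℝ] E)‖₊ = 1 := by
      ext; simp
    simpa [this] using htK
  have hderiv : ∀ x ∈ ball (0 : E) 1,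
      HasFDerivWithinAt f (1 + (t : ℝ) • (fderiv ℝ R x - 1)) (ball 0 1) x := fun x hx =>
    ((hasFDerivAt_id x).add
      (((hdiff x hx).hasFDerivAt.sub (hasFDerivAt_id x)).const_smul (t : ℝ))).hasFDerivWithinAt
  have hchange := integral_image_eq_integral_abs_det_fderiv_smul μ measurableSet_ball hderiv hinj
    (fun _ => (1 : ℝ))
  rw [himage, setIntegral_const] at hchange
  simp only [smul_eq_mul, mul_one] at hchange
  rw [hchange]
  refine setIntegral_congr_fun measurableSet_ball fun x hx => (abs_of_pos ?_).symm
  refine ContinuousLinearMap.det_one_add_pos ?_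
  have hle := norm_fderiv_le_of_lipschitzOn ℝ (closedBall_mem_nhds_of_mem hx) hLip
  have hfd : fderiv ℝ (fun y => R y - y) x = fderiv ℝ R x - 1 :=
    ((hdiff x hx).hasFDerivAt.sub (hasFDerivAt_id x)).fderiv
  rw [hfd] at hle
  rw [norm_smul, Real.norm_of_nonneg t.coe_nonneg]
  exact (mul_le_mul_of_nonneg_left hle t.coe_nonneg).trans_lt (by exact_mod_cast htK)

theorem not_exists_contDiffOn_retraction_sphere {R : E → E} {U : Set E} (hU : IsOpen U)
    (hBU : closedBall 0 1 ⊆ U) (hR : ContDiffOn ℝ 1 R U)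
    (hmaps : MapsTo R (closedBall 0 1) (sphere 0 1))
    (hfix : ∀ x ∈ sphere (0 : E) 1, R x = x) : False := by
  borelize E
  let μ : Measure E := Measure.addHaar
  have hdiff : ∀ x ∈ ball (0 : E) 1, DifferentiableAt ℝ R x := fun x hx =>
    (hR.differentiableOn one_ne_zero).differentiableAt
      (hU.mem_nhds (hBU (ball_subset_closedBall hx)))
  obtain ⟨K, hK⟩ := ((hR.mono hBU).sub contDiffOn_id).exists_lipschitzOnWith one_ne_zero
    (convex_closedBall (0 : E) 1) (isCompact_closedBall 0 1)
  let v (i : ℕ) : ℝ≥0 := (K + 2 + i)⁻¹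
  have hv : Function.Injective fun i => (v i : ℝ) := by
    intro i j hij
    simpa [v] using hij
  have hv1 (i : ℕ) : v i < 1 := by
    refine inv_lt_one_of_one_lt₀ ?_
    have : (1 : ℝ≥0) < 2 := by norm_num
    exact this.trans_le (by rw [add_right_comm]; exact le_add_self)
  have hvK (i : ℕ) : v i * K < 1 := by
    rw [inv_mul_lt_iff₀ (by positivity), mul_one, add_assoc]
    exact lt_add_of_pos_right _ (by positivity)
  obtain ⟨c, hc⟩ := Polynomial.exists_weights_eval_one_eq_sum (Module.finrank ℝ E) hv
  have hdet (x : E) : (fderiv ℝ R x).det = ∑ i ∈ Finset.range (Module.finrank ℝ E + 1),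
      c i * (1 + (v i : ℝ) • (fderiv ℝ R x - 1)).det := by
    obtain ⟨p, hp, hpe⟩ :=
      LinearMap.exists_polynomial_eval_eq_det_one_add_smul
        (fderiv ℝ R x - 1 : E →L[ℝ] E).toLinearMap
    have h := hc p hp
    simp only [hpe] at h
    convert h using 2
    · ext; simp
    · rfl
  have hint (i : ℕ) : IntegrableOn (fun x => (1 + (v i : ℝ) • (fderiv ℝ R x - 1)).det)
      (ball 0 1) μ := by
    refine (ContinuousOn.integrableOn_compact (isCompact_closedBall 0 1) ?_).mono_set
      ball_subset_closedBall
    have h := (hR.continuousOn_fderiv_of_isOpen hU le_rfl).mono hBU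
    exact ContinuousLinearMap.continuous_det.comp_continuousOn (by fun_prop)
  have hsum : ∑ i ∈ Finset.range (Module.finrank ℝ E + 1), c i = 1 := by
    simpa using (hc 1 (by simp)).symm
  have hvol : ∫ x in ball (0 : E) 1, (fderiv ℝ R x).det ∂μ = μ.real (ball 0 1) := by
    simp_rw [hdet]
    rw [integral_finsetSum _ fun i _ => (hint i).const_mul (c i)]
    simp_rw [integral_const_mul]
    rw [Finset.sum_congr rfl fun i _ => by
      rw [setIntegral_det_one_add_smul_fderiv μ hdiff hK
        (hmaps.mono_right sphere_subset_closedBall) hfix (hv1 i) (hvK i)]]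
    rw [← Finset.sum_mul, hsum, one_mul]
  have hzero : ∫ x in ball (0 : E) 1, (fderiv ℝ R x).det ∂μ = 0 :=
    setIntegral_eq_zero_of_forall_eq_zero fun x hx =>
      det_fderiv_eq_zero_of_norm_eq_one (hdiff x hx) <| by
        filter_upwards [closedBall_mem_nhds_of_mem hx] with y hy
        simpa using hmaps hy
  exact (ENNReal.toReal_pos (measure_ball_pos μ (0 : E) one_pos).ne'
    measure_ball_lt_top.ne).ne' (hvol.symm.trans hzero)

end Retraction

/-- No-retraction theorem (smooth version): there is no map `R : ℝⁿ → ℝⁿ` which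
is `C²` on a neighborhood of the closed unit ball `B`, maps `B` into the unit
sphere, and fixes every point of the unit sphere. -/
theorem no_smooth_retraction
    (n : ℕ) (hn : 1 ≤ n) :
    ¬ ∃ (R : EuclideanSpace ℝ (Fin n) → EuclideanSpace ℝ (Fin n))
        (U : Set (EuclideanSpace ℝ (Fin n))),
        IsOpen U ∧
        Metric.closedBall (0 : EuclideanSpace ℝ (Fin n)) 1 ⊆ U ∧
        ContDiffOn ℝ 2 R U ∧
        (∀ x ∈ Metric.closedBall (0 : EuclideanSpace ℝ (Fin n)) 1,
          R x ∈ Metric.sphere (0 : EuclideanSpace ℝ (Fin n)) 1) ∧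
        (∀ x ∈ Metric.sphere (0 : EuclideanSpace ℝ (Fin n)) 1, R x = x) := by
  rintro ⟨R, U, hU, hBU, hR, hmaps, hfix⟩
  have : Nonempty (Fin n) := ⟨⟨0, hn⟩⟩
  exact not_exists_contDiffOn_retraction_sphere hU hBU (hR.of_le one_le_two) hmaps hfix
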